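/- Let J be the tree on vertices u_1, …, u_7, w_3, w_5 where u_1 u_2 … u_7 is a path, w_3 is adjacent to u_3 and w_5 is adjacent to u_5. Then: (a) there is no (1,2,2)-packing coloring c of J with c(u_1) = c(u_7) ∈ {2, 3}, i.e., u_1 and u_7 never receive the same color from the two 2-packing classes; and (b) there exists a (1,2,2)-packing coloring of J with c(u_1) = 2 and c(u_7) = 3. -/

import Mathlib

/-- `c` is an `s`-packing coloring of the simple graph `G`: for each color `i`, any two
distinct vertices with color `i` are at graph distance strictly greater than `s i`
(vertices in different connected components trivially satisfy this). -/
def IsPackingColoring {V : Type*} (G : SimpleGraph V) {k : ℕ} (s : Fin k → ℕ)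
    (c : V → Fin k) : Prop :=
  ∀ u v : V, u ≠ v → c u = c v → G.Reachable u v → s (c u) < G.dist u v

/-- The tree `J`: a path `u₁ u₂ … u₇` (vertices `0,…,6`) with `w₃ = 7` adjacent to
`u₃ = 2` and `w₅ = 8` adjacent to `u₅ = 4`. -/
def treeJ : SimpleGraph (Fin 9) :=
  SimpleGraph.fromRel (fun u v =>
    (u, v) ∈ ([(0,1),(1,2),(2,3),(3,4),(4,5),(5,6),(2,7),(4,8)] : List (Fin 9 × Fin 9)))

theorem SimpleGraph.exists_adj_adj_of_dist_eq_two {V : Type*} {G : SimpleGraph V} {u v : V}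
    (h : G.dist u v = 2) : ∃ w, G.Adj u w ∧ G.Adj w v := by
  have hr : G.Reachable u v := by
    by_contra hr
    simp [SimpleGraph.dist_eq_zero_of_not_reachable hr] at h
  obtain ⟨p, hp⟩ := hr.exists_walk_length_eq_dist
  rw [h] at hp
  match p, hp with
  | .cons h₁ (.cons h₂ .nil), _ => exact ⟨_, h₁, h₂⟩

theorem SimpleGraph.dist_le_two_of_adj_adj {V : Type*} {G : SimpleGraph V} {u v w : V}
    (h₁ : G.Adj u w) (h₂ : G.Adj w v) : G.dist u v ≤ 2 :=
  SimpleGraph.dist_le (.cons h₁ (.cons h₂ .nil))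

/-- A packing coloring for the list `(1, 2, 2)` is a proper coloring in which only color `0` may
repeat on the neighbors of a vertex. -/
theorem isPackingColoring_one_two_two_iff {V : Type*} {G : SimpleGraph V} {c : V → Fin 3} :
    IsPackingColoring G ![1, 2, 2] c ↔
      (∀ u v, G.Adj u v → c u ≠ c v) ∧
        ∀ u w v, G.Adj u w → G.Adj w v → u ≠ v → c u = c v → c u = 0 := by
  constructor
  · intro h
    refine ⟨fun u v huv hc => ?_, fun u w v h₁ h₂ hne hc => ?_⟩
    · have := h u v huv.ne hc huv.reachable
      rw [SimpleGraph.dist_eq_one_iff_adj.mpr huv] at this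
      generalize c u = i at this
      fin_cases i <;> simp at this
    · have h_lt := h u v hne hc (h₁.reachable.trans h₂.reachable)
      have h_le := SimpleGraph.dist_le_two_of_adj_adj h₁ h₂
      generalize c u = i at h_lt
      fin_cases i <;> simp at h_lt ⊢ <;> omega
  · rintro ⟨h_adj, h_two⟩ u v hne hc hr
    have h_one : 1 < G.dist u v :=
      hr.one_lt_dist_of_ne_of_not_adj hne fun huv => h_adj u v huv hc
    have h_or : c u = 0 ∨ 2 < G.dist u v := by
      by_contra! hcon
      obtain ⟨w, h₁, h₂⟩ := SimpleGraph.exists_adj_adj_of_dist_eq_two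
        (show G.dist u v = 2 by omega)
      exact hcon.1 (h_two u w v h₁ h₂ hne hc)
    generalize c u = i at h_or
    fin_cases i <;> simp at h_or ⊢ <;> omega

instance : DecidableRel treeJ.Adj := fun u v =>
  decidable_of_iff _ (SimpleGraph.fromRel_adj _ u v).symm

/-- A vertex with three distinct neighbors does not have color `0`. -/
theorem IsPackingColoring.ne_zero_of_three_adj {V : Type*} {G : SimpleGraph V} {c : V → Fin 3}
    (h : IsPackingColoring G ![1, 2, 2] c) {w x y z : V} (hx : G.Adj w x) (hy : G.Adj w y)
    (hz : G.Adj w z) (hxy : x ≠ y) (hxz : x ≠ z) (hyz : y ≠ z) : c w ≠ 0 := by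
  rw [isPackingColoring_one_two_two_iff] at h
  have hcx := h.1 w x hx
  have hcy := h.1 w y hy
  have hcz := h.1 w z hz
  have h₁ := h.2 x w y hx.symm hy hxy
  have h₂ := h.2 x w z hx.symm hz hxz
  have h₃ := h.2 y w z hy.symm hz hyz
  grind

/-- In a `(1,2,2)`-packing coloring (colors `0, 1, 2` where `1` and `2` are the two
`2`-packing classes): (a) `u₁` and `u₇` never receive the same color from `{1, 2}`;
(b) there is a coloring with `c u₁ = 1` and `c u₇ = 2`. -/
theorem treeJ_antitransmitter :
    (¬ ∃ c : Fin 9 → Fin 3, IsPackingColoring treeJ ![1, 2, 2] c ∧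
        c 0 = c 6 ∧ (c 0 = 1 ∨ c 0 = 2)) ∧
    (∃ c : Fin 9 → Fin 3, IsPackingColoring treeJ ![1, 2, 2] c ∧ c 0 = 1 ∧ c 6 = 2) := by
  constructor
  · rintro ⟨c, hc, h_eq, h_col⟩
    have h₂ : c 2 ≠ 0 := hc.ne_zero_of_three_adj (x := 1) (y := 3) (z := 7)
      (by decide) (by decide) (by decide) (by decide) (by decide) (by decide)
    have h₄ : c 4 ≠ 0 := hc.ne_zero_of_three_adj (x := 3) (y := 5) (z := 8)
      (by decide) (by decide) (by decide) (by decide) (by decide) (by decide)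
    rw [isPackingColoring_one_two_two_iff] at hc
    have h₀₂ := hc.2 0 1 2 (by decide) (by decide) (by decide)
    have h₂₄ := hc.2 2 3 4 (by decide) (by decide) (by decide)
    have h₄₆ := hc.2 4 5 6 (by decide) (by decide) (by decide)
    grind
  · refine ⟨![1, 0, 2, 0, 1, 0, 2, 0, 0], ?_, rfl, rfl⟩
    rw [isPackingColoring_one_two_two_iff]
    decide
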